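/- arXiv:2311.06619 — 3 statements merged into one kernel-verified Lean document; each statement's English description precedes it below -/
import Mathlib

section
/- Let n ≥ 2. The map (i, j) ↦ v_{i,j} from {2, …, n} × {2, …, n} to 𝔖_n is injective, and its image equals the set {w_{i,j} : i, j ∈ {1, …, n}, i ≠ j}; in particular, the set {w_{i,j} : i ≠ j} has cardinality (n − 1)². -/
/-- `wP n i j` is the permutation `w_{i+1,j+1}` of the paper (0-indexed version of
`w_{i,j}` from `\eqref{cyc}`): for `i < j` it is the cycle sending `i ↦ i+1, …, j-1 ↦ j, j ↦ i`;
for `i > j` it is the cycle sending `i ↦ i-1, …, j+1 ↦ j, j ↦ i`; and it is the identity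
for `i = j`. -/
def wP (n : ℕ) (i j : Fin n) : Equiv.Perm (Fin n) :=
  if i ≤ j then
    (finRotate n) ^ (i : ℕ) *
      Fin.cycleRange ⟨(j : ℕ) - (i : ℕ), lt_of_le_of_lt (Nat.sub_le _ _) j.isLt⟩ *
      ((finRotate n) ^ (i : ℕ))⁻¹
  else
    ((finRotate n) ^ (j : ℕ) *
      Fin.cycleRange ⟨(i : ℕ) - (j : ℕ), lt_of_le_of_lt (Nat.sub_le _ _) i.isLt⟩ *
      ((finRotate n) ^ (j : ℕ))⁻¹)⁻¹

/-- `xP n i` is the permutation `x_{i+1}` of the paper (0-indexed version of `x_i`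
from `\eqref{mini}`): it fixes `k < i`, sends `i ↦ n-1`, and sends `k ↦ k-1` for `k > i`.
It equals `w_{n,i+1}` in the paper's notation. -/
def xP (n : ℕ) (i : Fin n) : Equiv.Perm (Fin n) :=
  wP n ⟨n - 1, Nat.sub_lt i.pos Nat.one_pos⟩ i

/-- `vP n i j` is the permutation `v_{i+1,j+1}` of the paper (0-indexed version of
`v_{i,j}` from `\eqref{v_ij}`, meaningful for `i, j ≥ 1`, i.e. paper indices in
`{2,…,n}`): `v_{i,j} = w_{i-1,j}` if `i ≤ j` and `v_{i,j} = w_{i,j-1}` if `i > j`. -/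
def vP (n : ℕ) (i j : Fin n) : Equiv.Perm (Fin n) :=
  if i ≤ j then wP n ⟨(i : ℕ) - 1, lt_of_le_of_lt (Nat.sub_le _ _) i.isLt⟩ j
  else wP n i ⟨(j : ℕ) - 1, lt_of_le_of_lt (Nat.sub_le _ _) j.isLt⟩

theorem rot_val (m a : ℕ) (k : Fin (m+1)) :
    (((finRotate (m+1)) ^ a) k : ℕ) = ((k : ℕ) + a) % (m+1) := by
  induction a with
  | zero => simp [Nat.mod_eq_of_lt k.isLt]
  | succ a ih =>
    rw [pow_succ', Equiv.Perm.mul_apply, finRotate_apply, Fin.val_add, ih]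
    rw [Fin.val_one', ← Nat.add_mod, add_assoc]

theorem cyc_val (m : ℕ) (c k : Fin (m+1)) :
    (Fin.cycleRange c k : ℕ) =
      if (k : ℕ) < c then (k : ℕ) + 1 else if (k : ℕ) = c then 0 else k := by
  split_ifs with h1 h2
  · exact Fin.coe_cycleRange_of_lt h1
  · rw [Fin.cycleRange_of_eq (Fin.ext h2)]; rfl
  · rw [Fin.cycleRange_of_gt]
    exact Fin.lt_def.2 (by omega)

theorem up_val (m : ℕ) (a b k : Fin (m+1)) (hab : a ≤ b) :
    (wP (m+1) a b k : ℕ) = if (k : ℕ) < a then (k : ℕ) else if (k : ℕ) < b then (k : ℕ) + 1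
      else if (k : ℕ) = b then a else k := by
  obtain ⟨l, rfl⟩ := ((finRotate (m+1)) ^ (a : ℕ)).surjective k
  have hab' : (a : ℕ) ≤ b := hab
  rw [wP, if_pos hab, Equiv.Perm.mul_apply, Equiv.Perm.mul_apply, Equiv.Perm.inv_def, Equiv.symm_apply_apply,
    rot_val, rot_val, cyc_val]
  have hl := l.isLt
  have hb := b.isLt
  have key : ∀ x : ℕ, x < m + 1 → (x + (a : ℕ)) % (m+1) =
      if x + (a : ℕ) < m + 1 then x + (a : ℕ) else x + a - (m+1) := by
    intro x hx
    split_ifs with h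
    · exact Nat.mod_eq_of_lt h
    · rw [Nat.mod_eq_sub_mod (by omega), Nat.mod_eq_of_lt (by omega)]
  have hc : (if (l : ℕ) < (b : ℕ) - a then (l : ℕ) + 1 else if (l : ℕ) = (b : ℕ) - a then 0
      else (l : ℕ)) < m + 1 := by split_ifs <;> omega
  simp only
  rw [key _ hc, key _ hl]
  split_ifs <;> omega

theorem down_eq (m : ℕ) (i j : Fin (m+1)) (h : j < i) :
    wP (m+1) i j = (wP (m+1) j i)⁻¹ := by
  rw [wP, if_neg (not_le.2 h), wP, if_pos h.le]

theorem up_inj (m : ℕ) (a b a' b' : Fin (m+1)) (h : a < b) (h' : a' < b')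
    (e : wP (m+1) a b = wP (m+1) a' b') : a = a' ∧ b = b' := by
  have e' : ∀ k, (wP (m+1) a b k : ℕ) = wP (m+1) a' b' k := fun k => by rw [e]
  simp only [up_val m _ _ _ h.le, up_val m _ _ _ h'.le] at e'
  have h1 := e' a
  have h2 := e' a'
  have h3 := e' b
  have h4 := e' b'
  rw [Fin.lt_def] at h h'
  rw [Fin.ext_iff, Fin.ext_iff]
  grind

theorem up_down (m : ℕ) (a b i j : Fin (m+1)) (h : a < b) (h' : j < i)
    (e : wP (m+1) a b = wP (m+1) i j) : a = j ∧ b = i ∧ (i : ℕ) = j + 1 := by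
  rw [down_eq m i j h', eq_inv_iff_mul_eq_one] at e
  have e' : ∀ k, wP (m+1) a b (wP (m+1) j i k) = k := fun k => by
    rw [← Equiv.Perm.mul_apply, e]; rfl
  have e' : ∀ k, (wP (m+1) a b (wP (m+1) j i k) : ℕ) = k := fun k => by rw [e']
  simp only [up_val m _ _ _ h.le, up_val m _ _ _ h'.le] at e'
  have h1 := e' a
  have h2 := e' b
  have h3 := e' i
  have h4 := e' j
  rw [Fin.lt_def] at h h'
  rw [Fin.ext_iff, Fin.ext_iff]
  grind

theorem adj_swap (m : ℕ) (i j : Fin (m+1)) (h : (i : ℕ) = j + 1) :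
    wP (m+1) i j = wP (m+1) j i := by
  have hl : j < i := Fin.lt_def.2 (by omega)
  rw [down_eq m i j hl, inv_eq_iff_mul_eq_one]
  ext k
  rw [Equiv.Perm.mul_apply, up_val m _ _ _ hl.le, up_val m _ _ _ hl.le, Equiv.Perm.one_apply]
  grind

/-- Let `n ≥ 2`. The map `(i,j) ↦ v_{i,j}` on `{2,…,n} × {2,…,n}`
(0-indexed: `i, j : Fin n` with `1 ≤ i, j`) is injective, its image equals the set
`{w_{i,j} : i ≠ j}`, and the latter set has cardinality `(n-1)²`. -/
theorem vP_injective_image_card (n : ℕ) (hn : 2 ≤ n) :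
    (∀ i j i' j' : Fin n, 1 ≤ (i : ℕ) → 1 ≤ (j : ℕ) → 1 ≤ (i' : ℕ) → 1 ≤ (j' : ℕ) →
        vP n i j = vP n i' j' → i = i' ∧ j = j') ∧
      {w : Equiv.Perm (Fin n) | ∃ i j : Fin n, 1 ≤ (i : ℕ) ∧ 1 ≤ (j : ℕ) ∧ w = vP n i j}
        = {w : Equiv.Perm (Fin n) | ∃ i j : Fin n, i ≠ j ∧ w = wP n i j} ∧
      Set.ncard {w : Equiv.Perm (Fin n) | ∃ i j : Fin n, i ≠ j ∧ w = wP n i j}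
        = (n - 1) ^ 2 := by
  obtain ⟨m, rfl⟩ : ∃ m, n = m + 1 := ⟨n - 1, by omega⟩
  have inj : ∀ i j i' j' : Fin (m+1), 1 ≤ (i : ℕ) → 1 ≤ (j : ℕ) → 1 ≤ (i' : ℕ) →
      1 ≤ (j' : ℕ) → vP (m+1) i j = vP (m+1) i' j' → i = i' ∧ j = j' := by
    intro i j i' j' hi hj hi' hj' e
    unfold vP at e
    split_ifs at e with h h' h' <;> rw [Fin.le_def] at h h'
    · have := up_inj m _ _ _ _ (Fin.lt_def.2 (by simp only; omega))
        (Fin.lt_def.2 (by simp only; omega)) e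
      simp only [Fin.ext_iff] at this ⊢
      omega
    · have := up_down m _ _ _ _ (Fin.lt_def.2 (by simp only; omega))
        (Fin.lt_def.2 (by simp only; omega)) e
      simp only [Fin.ext_iff] at this ⊢
      omega
    · have := up_down m _ _ _ _ (Fin.lt_def.2 (by simp only; omega))
        (Fin.lt_def.2 (by simp only; omega)) e.symm
      simp only [Fin.ext_iff] at this ⊢
      omega
    · rw [down_eq m i _ (Fin.lt_def.2 (by simp only; omega)),
        down_eq m i' _ (Fin.lt_def.2 (by simp only; omega)), inv_inj] at e
      have := up_inj m _ _ _ _ (Fin.lt_def.2 (by simp only; omega))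
        (Fin.lt_def.2 (by simp only; omega)) e
      simp only [Fin.ext_iff] at this ⊢
      omega
  have up_mem : ∀ i j : Fin (m+1), i < j → ∃ a b : Fin (m+1), 1 ≤ (a : ℕ) ∧ 1 ≤ (b : ℕ) ∧
      wP (m+1) i j = vP (m+1) a b := by
    intro i j h
    rw [Fin.lt_def] at h
    refine ⟨⟨i + 1, by omega⟩, j, by simp, by omega, ?_⟩
    rw [vP, if_pos (Fin.le_def.2 (by simp only; omega))]
    rfl
  have img : {w : Equiv.Perm (Fin (m+1)) | ∃ i j : Fin (m+1), 1 ≤ (i : ℕ) ∧ 1 ≤ (j : ℕ) ∧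
      w = vP (m+1) i j}
        = {w : Equiv.Perm (Fin (m+1)) | ∃ i j : Fin (m+1), i ≠ j ∧ w = wP (m+1) i j} := by
    ext w
    constructor
    · rintro ⟨i, j, hi, hj, rfl⟩
      unfold vP
      split_ifs with h <;> rw [Fin.le_def] at h
      · exact ⟨_, _, fun h' => by simp only [Fin.ext_iff] at h'; omega, rfl⟩
      · exact ⟨_, _, fun h' => by simp only [Fin.ext_iff] at h'; omega, rfl⟩
    · rintro ⟨i, j, hij, rfl⟩
      rcases lt_or_gt_of_ne hij with h | h
      · exact up_mem i j h
      · by_cases h1 : (i : ℕ) = j + 1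
        · rw [adj_swap m i j h1]
          exact up_mem j i h
        · rw [Fin.lt_def] at h
          refine ⟨i, ⟨j + 1, by omega⟩, by omega, by simp, ?_⟩
          rw [vP, if_neg (fun h' => by rw [Fin.le_def] at h'; simp only at h'; omega)]
          rfl
  refine ⟨inj, img, ?_⟩
  rw [← img]
  have hr : {w : Equiv.Perm (Fin (m+1)) | ∃ i j : Fin (m+1), 1 ≤ (i : ℕ) ∧ 1 ≤ (j : ℕ) ∧
      w = vP (m+1) i j} = Set.range (fun p : Fin m × Fin m => vP (m+1) p.1.succ p.2.succ) := by
    ext w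
    constructor
    · rintro ⟨i, j, hi, hj, rfl⟩
      refine ⟨(⟨i - 1, by omega⟩, ⟨j - 1, by omega⟩), ?_⟩
      have h1 : Fin.succ (⟨i - 1, by omega⟩ : Fin m) = i := by ext; simp; omega
      have h2 : Fin.succ (⟨j - 1, by omega⟩ : Fin m) = j := by ext; simp; omega
      simp only [h1, h2]
    · rintro ⟨p, rfl⟩
      exact ⟨_, _, by simp, by simp, rfl⟩
  rw [hr, ← Nat.card_coe_set_eq, Nat.card_range_of_injective]
  · simp [sq]
  · rintro ⟨a, b⟩ ⟨c, d⟩ e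
    have := inj _ _ _ _ (by simp) (by simp) (by simp) (by simp) e
    simpa using this
end

section
/- Let n ≥ 2, let V be a vector space over ℂ, let u_{k,l} ∈ V for k, l ∈ {2, …, n}, and let u_0 ∈ V. For i, j ∈ {1, …, n} define P_{i,j} := ∑_{(k,l) ∈ [i] × [j]} u_{k,l} + δ_{i,j} u_0, where δ_{i,j} is the Kronecker symbol. Then for all i, j ∈ {2, …, n}: u_{i,j} = ∑_{i ≤ k ≤ n, j ≤ l ≤ n} (−1)^{(k−i)+(l−j)} P_{k,l} + (−1)^{i+j−1} (n − max{i, j} + 1) u_0. -/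
/-- `brkt n i` is the paper's set `[i] = {i, i+1} ∩ {2, …, n}`. -/
def brkt (n i : ℕ) : Finset ℕ := ({i, i + 1} : Finset ℕ) ∩ Finset.Icc 2 n

lemma brkt_telescope {V : Type*} [AddCommGroup V] [Module ℂ V] (n : ℕ) (f : ℕ → V) :
    ∀ d i : ℕ, 2 ≤ i → i + d = n →
      ∑ k ∈ Finset.Icc i n, ((-1 : ℂ) ^ (k - i)) • ∑ m ∈ brkt n k, f m = f i := by
  intro d
  induction d with
  | zero =>
    intro i hi h
    obtain rfl : i = n := by omega
    have hb : brkt i i = {i} := by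
      ext x
      simp only [brkt, Finset.mem_inter, Finset.mem_insert, Finset.mem_singleton, Finset.mem_Icc]
      omega
    simp [hb]
  | succ d ih =>
    intro i hi h
    have hb : brkt n i = {i, i + 1} := by
      ext x
      simp only [brkt, Finset.mem_inter, Finset.mem_insert, Finset.mem_singleton, Finset.mem_Icc]
      omega
    have hI : Finset.Icc i n = insert i (Finset.Icc (i + 1) n) := by
      ext x
      simp only [Finset.mem_insert, Finset.mem_Icc]
      omega
    rw [hI, Finset.sum_insert (by simp), hb, Finset.sum_pair (by omega)]
    have h2 : ∑ k ∈ Finset.Icc (i + 1) n, ((-1 : ℂ) ^ (k - i)) • ∑ m ∈ brkt n k, f m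
        = - f (i + 1) := by
      rw [← ih (i + 1) (by omega) (by omega), ← Finset.sum_neg_distrib]
      refine Finset.sum_congr rfl fun k hk => ?_
      rw [Finset.mem_Icc] at hk
      rw [show k - i = (k - (i + 1)) + 1 by omega, pow_succ]
      simp
    rw [h2]
    simp

lemma delta_sum {V : Type*} [AddCommGroup V] [Module ℂ V] (n i j : ℕ) (u0 : V)
    (hi : i ≤ n) (hj : j ≤ n) :
    ∑ k ∈ Finset.Icc i n, ∑ l ∈ Finset.Icc j n,
      ((-1 : ℂ) ^ ((k - i) + (l - j))) • (if k = l then u0 else 0)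
      = ((-1 : ℂ) ^ (i + j) * ((n - max i j + 1 : ℕ) : ℂ)) • u0 := by
  have h1 : ∀ k ∈ Finset.Icc i n, ∑ l ∈ Finset.Icc j n,
      ((-1 : ℂ) ^ ((k - i) + (l - j))) • (if k = l then u0 else 0)
      = if j ≤ k then ((-1 : ℂ) ^ (i + j)) • u0 else 0 := by
    intro k hk
    rw [Finset.mem_Icc] at hk
    simp only [smul_ite, smul_zero, Finset.sum_ite_eq, Finset.mem_Icc, hk.2, and_true]
    split_ifs with h
    · congr 1
      apply neg_one_pow_congr
      rw [Nat.even_iff, Nat.even_iff]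
      omega
    · rfl
  rw [Finset.sum_congr rfl h1, ← Finset.sum_filter, Finset.sum_const]
  have h2 : (Finset.Icc i n).filter (fun k => j ≤ k) = Finset.Icc (max i j) n := by
    ext x
    simp only [Finset.mem_filter, Finset.mem_Icc]
    omega
  rw [h2, Nat.card_Icc, show n + 1 - max i j = n - max i j + 1 by omega,
    ← Nat.cast_smul_eq_nsmul ℂ, smul_smul, mul_comm]

/-- Let `n ≥ 2`, `V` a ℂ-vector space, `u k l ∈ V` for
`k, l ∈ {2,…,n}`, `u₀ ∈ V`, and for `i, j ∈ {1,…,n}` let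
`P i j = ∑_{(k,l) ∈ [i]×[j]} u k l + δ_{i,j} u₀`. Then for all `i, j ∈ {2,…,n}`:
`u i j = ∑_{i≤k≤n, j≤l≤n} (−1)^{(k−i)+(l−j)} P k l + (−1)^{i+j−1} (n − max i j + 1) u₀`. -/
theorem inversion_formula_min_GK_coherent_families
    (n : ℕ) (hn : 2 ≤ n) (V : Type*) [AddCommGroup V] [Module ℂ V]
    (u : ℕ → ℕ → V) (u0 : V) (P : ℕ → ℕ → V)
    (hP : ∀ i ∈ Finset.Icc 1 n, ∀ j ∈ Finset.Icc 1 n,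
      P i j = (∑ k ∈ brkt n i, ∑ l ∈ brkt n j, u k l) + (if i = j then u0 else 0)) :
    ∀ i ∈ Finset.Icc 2 n, ∀ j ∈ Finset.Icc 2 n,
      u i j = (∑ k ∈ Finset.Icc i n, ∑ l ∈ Finset.Icc j n,
          ((-1 : ℂ) ^ ((k - i) + (l - j))) • P k l)
        + (((-1 : ℂ) ^ (i + j - 1) * ((n - max i j + 1 : ℕ) : ℂ)) • u0) := by
  intro i hi j hj
  rw [Finset.mem_Icc] at hi hj
  have h1 : ∑ k ∈ Finset.Icc i n, ∑ l ∈ Finset.Icc j n, ((-1 : ℂ) ^ ((k - i) + (l - j))) • P k l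
      = u i j + ((-1 : ℂ) ^ (i + j) * ((n - max i j + 1 : ℕ) : ℂ)) • u0 := by
    rw [← delta_sum n i j u0 hi.2 hj.2,
      ← brkt_telescope n (fun m => u m j) (n - i) i hi.1 (by omega), ← Finset.sum_add_distrib]
    refine Finset.sum_congr rfl fun k hk => ?_
    rw [Finset.mem_Icc] at hk
    have h2 : ∑ m ∈ brkt n k, u m j = ∑ l ∈ Finset.Icc j n,
        ((-1 : ℂ) ^ (l - j)) • ∑ m ∈ brkt n k, ∑ p ∈ brkt n l, u m p := by
      simp_rw [Finset.smul_sum (s := brkt n k)]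
      rw [Finset.sum_comm]
      refine Finset.sum_congr rfl fun m _ => ?_
      exact (brkt_telescope n (fun p => u m p) (n - j) j hj.1 (by omega)).symm
    rw [h2, Finset.smul_sum, ← Finset.sum_add_distrib]
    refine Finset.sum_congr rfl fun l hl => ?_
    rw [Finset.mem_Icc] at hl
    rw [hP k (Finset.mem_Icc.2 (by omega)) l (Finset.mem_Icc.2 (by omega)), smul_add, smul_smul,
      ← pow_add]
  rw [h1, add_assoc, ← add_smul]
  have h3 : (-1 : ℂ) ^ (i + j) = - (-1 : ℂ) ^ (i + j - 1) := by
    conv_lhs => rw [show i + j = (i + j - 1) + 1 by omega, pow_succ]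
    ring
  rw [h3]
  simp
end

section
/- Let n ≥ 2, let V be a vector space over ℂ, let u_{k,l} ∈ V for k, l ∈ {2, …, n}, and let u_0 ∈ V. For i, j ∈ {1, …, n} define P_{i,j} := ∑_{(k,l) ∈ [i] × [j]} u_{k,l} + δ_{i,j} u_0, where δ_{i,j} is the Kronecker symbol. If the family consisting of the (n−1)² vectors u_{k,l} (k, l ∈ {2,…,n}) together with u_0 is linearly independent, then the family consisting of the (n−1)² vectors P_{i,j} (i, j ∈ {2,…,n}) together with u_0 is linearly independent and spans the same subspace of V; i.e., it is a basis of span({u_{k,l} : k, l ∈ {2,…,n}} ∪ {u_0}). -/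
/-- Let `n ≥ 2`, `V` a ℂ-vector space, `u k l ∈ V` for
`k, l ∈ {2,…,n}`, `u₀ ∈ V`, and for `i, j ∈ {1,…,n}` let
`P i j = ∑_{(k,l) ∈ [i]×[j]} u k l + δ_{i,j} u₀`. If the family consisting of the
`(n−1)²` vectors `u k l` (`k, l ∈ {2,…,n}`) together with `u₀` is linearly
independent, then the family consisting of the `(n−1)²` vectors `P i j`
(`i, j ∈ {2,…,n}`) together with `u₀` is linearly independent and spans the same
subspace, i.e. it is a basis of
`span ({u k l : k, l ∈ {2,…,n}} ∪ {u₀})`. -/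
theorem induced_family_is_basis
    (n : ℕ) (hn : 2 ≤ n) (V : Type*) [AddCommGroup V] [Module ℂ V]
    (u : ℕ → ℕ → V) (u0 : V) (P : ℕ → ℕ → V)
    (hP : ∀ i ∈ Finset.Icc 1 n, ∀ j ∈ Finset.Icc 1 n,
      P i j = (∑ k ∈ brkt n i, ∑ l ∈ brkt n j, u k l) + (if i = j then u0 else 0))
    (hu : LinearIndependent ℂ
      (fun x : Option (↥(Finset.Icc 2 n) × ↥(Finset.Icc 2 n)) =>
        x.elim u0 (fun p => u p.1.1 p.2.1))) :
    LinearIndependent ℂ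
        (fun x : Option (↥(Finset.Icc 2 n) × ↥(Finset.Icc 2 n)) =>
          x.elim u0 (fun p => P p.1.1 p.2.1)) ∧
      Submodule.span ℂ
          ({v : V | ∃ i ∈ Finset.Icc 2 n, ∃ j ∈ Finset.Icc 2 n, v = P i j} ∪ {u0})
        = Submodule.span ℂ
          ({v : V | ∃ k ∈ Finset.Icc 2 n, ∃ l ∈ Finset.Icc 2 n, v = u k l} ∪ {u0}) := by
  have hspan : Submodule.span ℂ
          ({v : V | ∃ i ∈ Finset.Icc 2 n, ∃ j ∈ Finset.Icc 2 n, v = P i j} ∪ {u0})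
        = Submodule.span ℂ
          ({v : V | ∃ k ∈ Finset.Icc 2 n, ∃ l ∈ Finset.Icc 2 n, v = u k l} ∪ {u0}) := by
    apply le_antisymm
    · rw [Submodule.span_le]
      rintro v (⟨i, hi, j, hj, rfl⟩ | hv)
      · rw [Finset.mem_Icc] at hi hj
        rw [hP i (Finset.mem_Icc.2 ⟨by omega, hi.2⟩) j (Finset.mem_Icc.2 ⟨by omega, hj.2⟩)]
        refine Submodule.add_mem _ ?_ ?_
        · refine Submodule.sum_mem _ fun k hk => Submodule.sum_mem _ fun l hl => ?_
          exact Submodule.subset_span (Or.inl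
            ⟨k, (Finset.mem_inter.1 hk).2, l, (Finset.mem_inter.1 hl).2, rfl⟩)
        · split_ifs
          · exact Submodule.subset_span (Or.inr rfl)
          · exact Submodule.zero_mem _
      · exact Submodule.subset_span (Or.inr hv)
    · rw [Submodule.span_le]
      set S := Submodule.span ℂ
          ({v : V | ∃ i ∈ Finset.Icc 2 n, ∃ j ∈ Finset.Icc 2 n, v = P i j} ∪ {u0}) with hS
      have h0 : u0 ∈ S := Submodule.subset_span (Or.inr rfl)
      have key : ∀ m : ℕ, ∀ k ∈ Finset.Icc 2 n, ∀ l ∈ Finset.Icc 2 n,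
          (n - k) + (n - l) = m → u k l ∈ S := by
        intro m
        induction m using Nat.strong_induction_on with
        | _ m ih =>
          intro k hk l hl hm
          have hk' := Finset.mem_Icc.1 hk
          have hl' := Finset.mem_Icc.1 hl
          have hPS : P k l ∈ S := Submodule.subset_span (Or.inl ⟨k, hk, l, hl, rfl⟩)
          have hd : (if k = l then u0 else 0) ∈ S := by
            split_ifs
            · exact h0
            · exact S.zero_mem
          rw [hP k (Finset.mem_Icc.2 ⟨by omega, hk'.2⟩) l (Finset.mem_Icc.2 ⟨by omega, hl'.2⟩),
            S.add_mem_iff_left hd, ← Finset.sum_product'] at hPS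
          have hmem : (k, l) ∈ brkt n k ×ˢ brkt n l := by
            simp [brkt, hk', hl']
          rw [← Finset.add_sum_erase _ _ hmem] at hPS
          refine (S.add_mem_iff_left (S.sum_mem ?_)).1 hPS
          rintro ⟨a, b⟩ hab
          simp only [brkt, Finset.mem_erase, Finset.mem_product, Finset.mem_inter,
            Finset.mem_insert, Finset.mem_singleton, ne_eq, Prod.mk.injEq, Finset.mem_Icc] at hab
          exact ih _ (by omega) a (Finset.mem_Icc.2 hab.2.1.2) b (Finset.mem_Icc.2 hab.2.2.2) rfl
      rintro v (⟨i, hi, j, hj, rfl⟩ | hv)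
      · exact key _ i hi j hj rfl
      · exact Submodule.subset_span (Or.inr hv)
  refine ⟨?_, hspan⟩
  have hr : ∀ w : ℕ → ℕ → V,
      Set.range (fun x : Option (↥(Finset.Icc 2 n) × ↥(Finset.Icc 2 n)) =>
        x.elim u0 (fun p => w p.1.1 p.2.1))
      = {v : V | ∃ i ∈ Finset.Icc 2 n, ∃ j ∈ Finset.Icc 2 n, v = w i j} ∪ {u0} := by
    intro w
    ext v
    constructor
    · rintro ⟨_ | ⟨⟨i, hi⟩, ⟨j, hj⟩⟩, rfl⟩
      · exact Or.inr rfl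
      · exact Or.inl ⟨i, hi, j, hj, rfl⟩
    · rintro (⟨i, hi, j, hj, rfl⟩ | hv)
      · exact ⟨some (⟨i, hi⟩, ⟨j, hj⟩), rfl⟩
      · exact ⟨none, (Set.mem_singleton_iff.1 hv).symm⟩
  rw [linearIndependent_iff_card_eq_finrank_span, Set.finrank, hr] at hu ⊢
  rw [hspan]
  exact hu
end
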